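/- (Sufficiency for the single-utility S-BRP test.) Let X, A be finite nonempty sets, μ a prior on X, p_1,…,p_K stochastic kernels from X to A, u : X × A → ℝ a shared utility, λ_1,…,λ_K > 0 and c_1,…,c_K ∈ ℝ. Define q_k(x,a) = μ(x) p_k(a|x) and suppose each q_k satisfies NIAS for u, and for all j, k ∈ {1,…,K}: ∑_{x∈X}∑_{a∈A} (q_j(x,a) − q_k(x,a)) u(x,a) + λ_k (c_k − c_j) ≤ 0. Then the function C(p) = max_{1≤j≤K} [ c_j + λ_j^{−1} ( J_A(μ, p, u) − J_A(μ, p_j, u) ) ] is convex on stochastic kernels from X to A, satisfies C(p_k) = c_k for every k, and for every k and every stochastic kernel p from X to A, J_A(μ, p_k, u) − λ_k C(p_k) ≥ J_A(μ, p, u) − λ_k C(p). -/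

import Mathlib

open Finset

/-- A stochastic kernel from `S` to `T`: `κ s t` is the probability of `t` given `s`. -/
def IsKernel {S T : Type*} [Fintype T] (κ : S → T → ℝ) : Prop :=
  (∀ s t, 0 ≤ κ s t) ∧ ∀ s, ∑ t, κ s t = 1

/-- A prior on a finite set `X`. -/
def IsPrior {X : Type*} [Fintype X] (μ : X → ℝ) : Prop :=
  (∀ x, 0 ≤ μ x) ∧ ∑ x, μ x = 1

/-- Maximum of a real-valued function over a finite nonempty type. -/
noncomputable def maxOver {A : Type*} [Fintype A] [Nonempty A] (f : A → ℝ) : ℝ :=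
  Finset.univ.sup' Finset.univ_nonempty f

/-- Maximal expected utility of attention strategy `α` under prior `μ` and utility `u`. -/
noncomputable def J {X Y A : Type*} [Fintype X] [Fintype Y] [Fintype A] [Nonempty A]
    (μ : X → ℝ) (α : X → Y → ℝ) (u : X → A → ℝ) : ℝ :=
  ∑ y, maxOver (fun a => ∑ x, μ x * α x y * u x a)

/-- Maximal expected utility of a direct strategy `p : X → A`. -/
noncomputable def JA {X A : Type*} [Fintype X] [Fintype A] [Nonempty A]
    (μ : X → ℝ) (p : X → A → ℝ) (u : X → A → ℝ) : ℝ :=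
  ∑ a, maxOver (fun b => ∑ x, μ x * p x a * u x b)

/-- `β` is an optimal decision rule for `(μ, α, u)`. -/
def OptimalRule {X Y A : Type*} [Fintype X] (μ : X → ℝ) (α : X → Y → ℝ)
    (u : X → A → ℝ) (β : Y → A → ℝ) : Prop :=
  ∀ y a, 0 < β y a → ∀ b, ∑ x, μ x * α x y * u x b ≤ ∑ x, μ x * α x y * u x a

/-- The NIAS (No-Improving-Action-Switches) inequalities. -/
def NIAS {X A : Type*} [Fintype X] (q u : X → A → ℝ) : Prop :=
  ∀ a b, ∑ x, q x a * (u x b - u x a) ≤ 0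

/-- The NIAC (No-Improving-Action-Cycles) inequalities for a collection of agents. -/
def NIAC {K X A : Type*} [Fintype X] [Fintype A] [Nonempty A]
    (q u : K → X → A → ℝ) (c : K → ℝ) : Prop :=
  ∀ j k, (∑ a, maxOver (fun b => ∑ x, q j x a * u k x b)) - c j
    - (∑ x, ∑ a, q k x a * u k x a) + c k ≤ 0

/-- The reconstructed information acquisition cost for the single-utility S-BRP test. -/
noncomputable def reconCostS {X A K : Type*} [Fintype X] [Fintype A] [Nonempty A]
    [Fintype K] [Nonempty K]
    (μ : X → ℝ) (p : K → X → A → ℝ) (u : X → A → ℝ) (lam c : K → ℝ)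
    (p' : X → A → ℝ) : ℝ :=
  maxOver (fun j => c j + (lam j)⁻¹ * (JA μ p' u - JA μ (p j) u))

theorem le_maxOver {A : Type*} [Fintype A] [Nonempty A] (f : A → ℝ) (a : A) :
    f a ≤ maxOver f :=
  Finset.le_sup' f (Finset.mem_univ a)

theorem maxOver_le {A : Type*} [Fintype A] [Nonempty A] {f : A → ℝ} {r : ℝ}
    (h : ∀ a, f a ≤ r) : maxOver f ≤ r :=
  Finset.sup'_le _ _ fun a _ => h a

/-- The maximum of a convex combination is at most the convex combination of the maxima. -/
theorem maxOver_le_of_le_combination {A : Type*} [Fintype A] [Nonempty A] {f g h : A → ℝ} {t : ℝ}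
    (h0 : 0 ≤ t) (h1 : t ≤ 1) (hf : ∀ a, f a ≤ t * g a + (1 - t) * h a) :
    maxOver f ≤ t * maxOver g + (1 - t) * maxOver h :=
  maxOver_le fun a => (hf a).trans <| add_le_add
    (mul_le_mul_of_nonneg_left (le_maxOver g a) h0)
    (mul_le_mul_of_nonneg_left (le_maxOver h a) (sub_nonneg.2 h1))

/-- The maximal expected utility is convex in the direct strategy. -/
theorem JA_combination_le {X A : Type*} [Fintype X] [Fintype A] [Nonempty A]
    (μ : X → ℝ) (p p' u : X → A → ℝ) {t : ℝ} (h0 : 0 ≤ t) (h1 : t ≤ 1) :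
    JA μ (fun x a => t * p x a + (1 - t) * p' x a) u ≤ t * JA μ p u + (1 - t) * JA μ p' u := by
  unfold JA
  rw [Finset.mul_sum, Finset.mul_sum, ← Finset.sum_add_distrib]
  refine Finset.sum_le_sum fun a _ => maxOver_le_of_le_combination h0 h1 fun b => le_of_eq ?_
  rw [Finset.mul_sum, Finset.mul_sum, ← Finset.sum_add_distrib]
  exact Finset.sum_congr rfl fun x _ => by ring

/-- Under NIAS, following the recommended action attains the maximal expected utility. -/
theorem JA_eq_of_NIAS {X A : Type*} [Fintype X] [Fintype A] [Nonempty A]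
    {μ : X → ℝ} {p u : X → A → ℝ} (h : NIAS (fun x a => μ x * p x a) u) :
    JA μ p u = ∑ x, ∑ a, μ x * p x a * u x a := by
  rw [Finset.sum_comm]
  refine Finset.sum_congr rfl fun a _ => le_antisymm (maxOver_le fun b => ?_)
    (le_maxOver (fun b => ∑ x, μ x * p x a * u x b) a)
  have hab := h a b
  simp only [mul_sub, Finset.sum_sub_distrib] at hab
  linarith

/-- Sufficiency for the single-utility S-BRP test: the reconstructed cost is
convex, matches the data, and makes each observed strategy globally optimal. -/
theorem sbrp_sufficiency {X A K : Type*} [Fintype X] [Nonempty X]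
    [Fintype A] [Nonempty A] [Fintype K] [Nonempty K]
    (μ : X → ℝ) (hμ : IsPrior μ)
    (p : K → X → A → ℝ) (hp : ∀ k, IsKernel (p k))
    (u : X → A → ℝ)
    (lam : K → ℝ) (hlam : ∀ k, 0 < lam k) (c : K → ℝ)
    (hNIAS : ∀ k, NIAS (fun x a => μ x * p k x a) u)
    (hineq : ∀ j k, (∑ x, ∑ a, (μ x * p j x a - μ x * p k x a) * u x a)
      + lam k * (c k - c j) ≤ 0) :
    (∀ (p' p'' : X → A → ℝ), IsKernel p' → IsKernel p'' →
      ∀ t : ℝ, 0 ≤ t → t ≤ 1 →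
        reconCostS μ p u lam c (fun x a => t * p' x a + (1 - t) * p'' x a)
          ≤ t * reconCostS μ p u lam c p' + (1 - t) * reconCostS μ p u lam c p'') ∧
    (∀ k, reconCostS μ p u lam c (p k) = c k) ∧
    (∀ k, ∀ p' : X → A → ℝ, IsKernel p' →
      JA μ p' u - lam k * reconCostS μ p u lam c p'
        ≤ JA μ (p k) u - lam k * reconCostS μ p u lam c (p k)) := by
  have hJ : ∀ j k, JA μ (p j) u - JA μ (p k) u + lam k * (c k - c j) ≤ 0 := by
    intro j k
    rw [JA_eq_of_NIAS (hNIAS j), JA_eq_of_NIAS (hNIAS k)]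
    simpa only [sub_mul, Finset.sum_sub_distrib] using hineq j k
  have hle : ∀ k p', c k + (lam k)⁻¹ * (JA μ p' u - JA μ (p k) u)
      ≤ reconCostS μ p u lam c p' := fun k p' =>
    le_maxOver (fun j => c j + (lam j)⁻¹ * (JA μ p' u - JA μ (p j) u)) k
  have hC : ∀ k, reconCostS μ p u lam c (p k) = c k := by
    intro k
    refine le_antisymm (maxOver_le fun j => ?_) (by simpa using hle k (p k))
    have hdiv : (lam j)⁻¹ * (JA μ (p k) u - JA μ (p j) u) ≤ c k - c j := by
      rw [inv_mul_le_iff₀ (hlam j)]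
      linarith [hJ k j]
    linarith
  refine ⟨fun p' p'' _ _ t h0 h1 => ?_, hC, fun k p' _ => ?_⟩
  · refine maxOver_le_of_le_combination h0 h1 fun j => ?_
    have hconv := mul_le_mul_of_nonneg_left (JA_combination_le μ p' p'' u h0 h1)
      (inv_nonneg.2 (hlam j).le)
    linarith
  · have hdiv : (lam k)⁻¹ * (JA μ p' u - JA μ (p k) u)
        ≤ reconCostS μ p u lam c p' - c k := by linarith [hle k p']
    rw [inv_mul_le_iff₀ (hlam k)] at hdiv
    rw [hC k]
    linarith
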